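/- For every t > 0, φ ≥ 0 and z ∈ ℝ, the map s ↦ j(s, φ, z) is differentiable at t, and the partial derivative ∂ₜ j satisfies the Gaussian integral bound ∫_ℝ |∂ₜ j(t, φ, z)| γ(z) dz ≤ e^{λt} ( φ((1/2)αC₁ t^{−1/2} + λ) + λ + (1/2)αC₁ t^{−1/2} ), where C₁ = √(2/π) is the first absolute moment of a standard Gaussian random variable. -/

import Mathlib

open MeasureTheory Real

/-- Standard Gaussian density on ℝ. -/
noncomputable def gaussDensity (z : ℝ) : ℝ := Real.exp (-z ^ 2 / 2) / Real.sqrt (2 * Real.pi)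

/-- One-step update of the conditional odds process upon observing a normalized
increment `z` after a waiting time `t`, starting from odds `φ`. -/
noncomputable def jfun (lam alp t φ z : ℝ) : ℝ :=
  Real.exp (alp * z * Real.sqrt t + (lam - alp ^ 2 / 2) * t) * φ +
    ∫ u in (0:ℝ)..t, lam * Real.exp ((lam + alp * z / Real.sqrt t) * u - alp ^ 2 * u ^ 2 / (2 * t))

lemma gd_cont : Continuous gaussDensity := by
  unfold gaussDensity
  fun_prop

lemma gd_nonneg (z : ℝ) : 0 ≤ gaussDensity z := by
  unfold gaussDensity
  positivity

lemma gd_eq (z : ℝ) : gaussDensity z = ProbabilityTheory.gaussianPDFReal 0 1 z := by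
  unfold gaussDensity ProbabilityTheory.gaussianPDFReal
  simp [div_eq_mul_inv, mul_comm]

lemma gd_int : Integrable gaussDensity := by
  rw [funext gd_eq]
  exact ProbabilityTheory.integrable_gaussianPDFReal 0 1

lemma gd_total : ∫ z, gaussDensity z = 1 := by
  simp_rw [gd_eq]
  exact ProbabilityTheory.integral_gaussianPDFReal_eq_one 0 (by norm_num)

lemma gd_abs_int : Integrable (fun z : ℝ => |z| * gaussDensity z) := by
  have h := (integrable_mul_exp_neg_mul_sq (b := 1 / 2) (by norm_num)).norm.mul_const
    (Real.sqrt (2 * Real.pi))⁻¹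
  refine h.congr (Filter.Eventually.of_forall fun z => ?_)
  simp only [gaussDensity, norm_mul, Real.norm_eq_abs, abs_exp]
  rw [show -(1 / 2 : ℝ) * z ^ 2 = -z ^ 2 / 2 by ring]
  ring

lemma gd_abs_total : ∫ z : ℝ, |z| * gaussDensity z = Real.sqrt (2 / Real.pi) := by
  have h1 : ∫ z : ℝ, |z| * gaussDensity z
      = ∫ z : ℝ, (fun x : ℝ => x * gaussDensity x) |z| := by
    refine integral_congr_ae (Filter.Eventually.of_forall fun z => ?_)
    simp [gaussDensity]
  rw [h1, integral_comp_abs (f := fun x : ℝ => x * gaussDensity x)]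
  have h2 : ∫ x in Set.Ioi (0:ℝ), x * gaussDensity x = 0 - (-(gaussDensity 0)) := by
    refine integral_Ioi_of_hasDerivAt_of_tendsto' (f := fun x => -gaussDensity x) ?_ ?_ ?_
    · intro x _
      have : HasDerivAt (fun x : ℝ => -x ^ 2 / 2) (-x) x := by
        have := ((hasDerivAt_pow 2 x).neg).div_const 2
        exact this.congr_deriv (by simp; ring)
      have := ((this.exp).div_const (Real.sqrt (2 * Real.pi))).neg
      unfold gaussDensity
      exact this.congr_deriv (by ring)
    · refine (gd_abs_int.integrableOn).congr_fun ?_ measurableSet_Ioi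
      intro x hx
      simp [abs_of_pos (Set.mem_Ioi.1 hx)]
    · have : Filter.Tendsto (fun x : ℝ => -(Real.exp (-(x ^ 2 / 2)) / Real.sqrt (2 * Real.pi)))
          Filter.atTop (nhds (-(0 / Real.sqrt (2 * Real.pi)))) := by
        refine ((Real.tendsto_exp_neg_atTop_nhds_zero.comp ?_).div_const _).neg
        exact (Filter.tendsto_pow_atTop (by norm_num)).atTop_div_const (by norm_num)
      simpa [gaussDensity, neg_div] using this
  rw [h2]
  simp only [gaussDensity]
  have hp := Real.pi_pos
  rw [Real.sqrt_div (by norm_num), Real.sqrt_mul (by norm_num)]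
  have h3 : Real.sqrt 2 * Real.sqrt 2 = 2 := Real.mul_self_sqrt (by norm_num)
  have h4 : 0 < Real.sqrt 2 := by positivity
  have h5 : 0 < Real.sqrt Real.pi := by positivity
  field_simp
  norm_num

/-- Shifted integrals. -/
lemma shift_int (a b c : ℝ) :
    Integrable (fun z : ℝ => (a + b * |z - c|) * gaussDensity (z - c)) := by
  have h : Integrable (fun z : ℝ => (a + b * |z|) * gaussDensity z) := by
    refine ((gd_int.const_mul a).add (gd_abs_int.const_mul b)).congr
      (Filter.Eventually.of_forall fun z => ?_)
    simp only [Pi.add_apply]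
    ring
  exact h.comp_sub_right c

lemma shift_total (a b c : ℝ) :
    ∫ z : ℝ, (a + b * |z - c|) * gaussDensity (z - c) = a + b * Real.sqrt (2 / Real.pi) := by
  rw [integral_sub_right_eq_self (fun z : ℝ => (a + b * |z|) * gaussDensity z) c]
  have : ∀ z : ℝ, (a + b * |z|) * gaussDensity z
      = a * gaussDensity z + b * (|z| * gaussDensity z) := fun z => by ring
  simp_rw [this]
  rw [integral_add (gd_int.const_mul a) (gd_abs_int.const_mul b), integral_const_mul,
    integral_const_mul, gd_total, gd_abs_total, mul_one]

lemma gd_shift (z c : ℝ) : Real.exp (c * z - c ^ 2 / 2) * gaussDensity z = gaussDensity (z - c) := by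
  unfold gaussDensity
  rw [← mul_div_assoc, ← Real.exp_add]
  congr 2
  ring

/-- Rescaled integrand and its time derivative. -/
noncomputable def jF (lam alp z s v : ℝ) : ℝ :=
  lam * s * Real.exp ((lam * s + alp * z * Real.sqrt s) * v - alp ^ 2 * s * v ^ 2 / 2)

noncomputable def jD (lam alp z s v : ℝ) : ℝ :=
  lam * Real.exp ((lam * s + alp * z * Real.sqrt s) * v - alp ^ 2 * s * v ^ 2 / 2) *
    (1 + lam * s * v + alp * z * v * Real.sqrt s / 2 - alp ^ 2 * s * v ^ 2 / 2)

lemma jD_cont (lam alp : ℝ) :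
    Continuous (fun p : ℝ × ℝ × ℝ => jD lam alp p.1 p.2.1 p.2.2) := by
  unfold jD
  fun_prop

lemma jF_deriv (lam alp z s v : ℝ) (hs : 0 < s) :
    HasDerivAt (fun s => jF lam alp z s v) (jD lam alp z s v) s := by
  have h1 := Real.hasDerivAt_sqrt hs.ne'
  have hid := hasDerivAt_id s
  have h2 := (((hid.const_mul lam).add (h1.const_mul (alp * z))).mul_const v).sub
    (((hid.const_mul (alp ^ 2)).mul_const (v ^ 2)).div_const 2)
  have h3 := (hid.const_mul lam).mul h2.exp
  unfold jF jD
  refine h3.congr_deriv ?_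
  have hq : 0 < Real.sqrt s := Real.sqrt_pos.2 hs
  have hqq : Real.sqrt s ^ 2 = s := Real.sq_sqrt hs.le
  simp only [id, Pi.add_apply, Pi.sub_apply]
  have : s / Real.sqrt s = Real.sqrt s := Real.div_sqrt
  rw [show (1 / (2 * Real.sqrt s)) = (1 / 2) * (Real.sqrt s)⁻¹ by field_simp]
  rw [div_eq_mul_inv] at this
  generalize Real.exp _ = E
  linear_combination (lam * E * alp * z * v / 2) * this

lemma jint_eq (lam alp z s : ℝ) (hs : 0 < s) :
    ∫ u in (0:ℝ)..s, lam * Real.exp ((lam + alp * z / Real.sqrt s) * u - alp ^ 2 * u ^ 2 / (2 * s))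
      = ∫ v in (0:ℝ)..1, jF lam alp z s v := by
  have h := intervalIntegral.smul_integral_comp_mul_left (a := 0) (b := 1)
    (fun u => lam * Real.exp ((lam + alp * z / Real.sqrt s) * u - alp ^ 2 * u ^ 2 / (2 * s))) s
  rw [mul_zero, mul_one] at h
  rw [← h, smul_eq_mul, ← intervalIntegral.integral_const_mul]
  refine intervalIntegral.integral_congr fun v _ => ?_
  have hq : 0 < Real.sqrt s := Real.sqrt_pos.2 hs
  have this : s / Real.sqrt s = Real.sqrt s := Real.div_sqrt
  simp only [jF]
  have e : (lam + alp * z / Real.sqrt s) * (s * v) - alp ^ 2 * (s * v) ^ 2 / (2 * s)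
      = (lam * s + alp * z * Real.sqrt s) * v - alp ^ 2 * s * v ^ 2 / 2 := by
    have e1 : alp ^ 2 * (s * v) ^ 2 / (2 * s) = alp ^ 2 * s * v ^ 2 / 2 := by field_simp
    rw [e1]
    linear_combination (alp * z * v) * this
  rw [e]
  ring

lemma jint_deriv (lam alp z t : ℝ) (ht : 0 < t) :
    HasDerivAt (fun s => ∫ v in (0:ℝ)..1, jF lam alp z s v)
      (∫ v in (0:ℝ)..1, jD lam alp z t v) t := by
  have hK : IsCompact (Set.Icc (t / 2) (2 * t) ×ˢ Set.Icc (0:ℝ) 1) :=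
    isCompact_Icc.prod isCompact_Icc
  have hc : Continuous (fun p : ℝ × ℝ => jD lam alp z p.1 p.2) := by
    unfold jD
    fun_prop
  obtain ⟨C, hC⟩ := hK.exists_bound_of_continuousOn hc.continuousOn
  refine (intervalIntegral.hasDerivAt_integral_of_dominated_loc_of_deriv_le
    (F := fun s v => jF lam alp z s v) (F' := fun s v => jD lam alp z s v)
    (bound := fun _ => C) (s := Set.Icc (t / 2) (2 * t)) ?_ ?_ ?_ ?_ ?_ ?_ ?_).2
  · exact Icc_mem_nhds (by linarith) (by linarith)
  · refine Filter.Eventually.of_forall fun s => Continuous.aestronglyMeasurable ?_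
    unfold jF
    fun_prop
  · refine Continuous.intervalIntegrable ?_ _ _
    unfold jF
    fun_prop
  · refine Continuous.aestronglyMeasurable ?_
    unfold jD
    fun_prop
  · refine Filter.Eventually.of_forall fun v hv s hs => ?_
    rw [Set.uIoc_of_le zero_le_one] at hv
    exact hC (s, v) ⟨hs, hv.1.le, hv.2⟩
  · exact intervalIntegrable_const
  · refine Filter.Eventually.of_forall fun v hv s hs => ?_
    exact jF_deriv lam alp z s v (by linarith [hs.1])

lemma jfun_hasDeriv (lam alp φ z t : ℝ) (ht : 0 < t) :
    HasDerivAt (fun s : ℝ => jfun lam alp s φ z)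
      (Real.exp (alp * z * Real.sqrt t + (lam - alp ^ 2 / 2) * t) *
        (alp * z * (1 / (2 * Real.sqrt t)) + (lam - alp ^ 2 / 2)) * φ
        + ∫ v in (0:ℝ)..1, jD lam alp z t v) t := by
  have h1 := Real.hasDerivAt_sqrt ht.ne'
  have h2 := ((h1.const_mul (alp * z)).add ((hasDerivAt_id t).const_mul (lam - alp ^ 2 / 2))).exp
  have h3 := (h2.mul_const φ).add (jint_deriv lam alp z t ht)
  refine (h3.congr_deriv ?_).congr_of_eventuallyEq ?_
  · simp
  · filter_upwards [lt_mem_nhds ht] with s hs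
    simp only [jfun, jint_eq lam alp z s hs]
    rfl

/-- Dominating kernel. -/
noncomputable def jH (lam alp t z v : ℝ) : ℝ :=
  lam * Real.exp (lam * t * v) *
    (((1 + lam * t * v) + alp * v * Real.sqrt t / 2 * |z - alp * v * Real.sqrt t|) *
      gaussDensity (z - alp * v * Real.sqrt t))

lemma jD_le (lam alp t z v : ℝ) (hlam : 0 < lam) (halp : 0 < alp) (ht : 0 < t) (hv : 0 ≤ v) :
    |jD lam alp z t v| * gaussDensity z ≤ jH lam alp t z v := by
  have hqq : Real.sqrt t ^ 2 = t := Real.sq_sqrt ht.le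
  unfold jH
  rw [← gd_shift z (alp * v * Real.sqrt t)]
  have e : jD lam alp z t v = lam * Real.exp (lam * t * v) *
      Real.exp (alp * v * Real.sqrt t * z - (alp * v * Real.sqrt t) ^ 2 / 2) *
      ((1 + lam * t * v) + alp * v * Real.sqrt t / 2 * (z - alp * v * Real.sqrt t)) := by
    rw [mul_assoc lam, ← Real.exp_add]
    unfold jD
    congr 1
    · congr 2
      linear_combination (alp ^ 2 * v ^ 2 / 2) * hqq
    · linear_combination (alp ^ 2 * v ^ 2 / 2) * hqq
  have h : |(1 + lam * t * v) + alp * v * Real.sqrt t / 2 * (z - alp * v * Real.sqrt t)| ≤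
      (1 + lam * t * v) + alp * v * Real.sqrt t / 2 * |z - alp * v * Real.sqrt t| := by
    refine (abs_add_le _ _).trans ?_
    rw [abs_mul, abs_of_nonneg (show 0 ≤ 1 + lam * t * v by positivity),
      abs_of_nonneg (show 0 ≤ alp * v * Real.sqrt t / 2 by positivity)]
  rw [e, abs_mul, abs_of_nonneg (show 0 ≤ lam * Real.exp (lam * t * v) *
      Real.exp (alp * v * Real.sqrt t * z - (alp * v * Real.sqrt t) ^ 2 / 2) by positivity)]
  have := gd_nonneg z
  calc _ ≤ lam * Real.exp (lam * t * v) *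
      Real.exp (alp * v * Real.sqrt t * z - (alp * v * Real.sqrt t) ^ 2 / 2) *
      ((1 + lam * t * v) + alp * v * Real.sqrt t / 2 * |z - alp * v * Real.sqrt t|) *
      gaussDensity z := by gcongr
    _ = _ := by ring

lemma jH_total (lam alp t v : ℝ) :
    ∫ z, jH lam alp t z v = lam * Real.exp (lam * t * v) *
      ((1 + lam * t * v) + alp * v * Real.sqrt t / 2 * Real.sqrt (2 / Real.pi)) := by
  unfold jH
  rw [integral_const_mul, shift_total]

lemma jH_cont (lam alp t : ℝ) : Continuous (fun p : ℝ × ℝ => jH lam alp t p.1 p.2) := by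
  unfold jH gaussDensity
  fun_prop

lemma jH_nonneg (lam alp t z v : ℝ) (hlam : 0 < lam) (halp : 0 < alp) (ht : 0 < t) (hv : 0 ≤ v) :
    0 ≤ jH lam alp t z v :=
  le_trans (mul_nonneg (abs_nonneg _) (gd_nonneg z)) (jD_le lam alp t z v hlam halp ht hv)

lemma jH_prod (lam alp t : ℝ) (hlam : 0 < lam) (halp : 0 < alp) (ht : 0 < t) :
    Integrable (fun p : ℝ × ℝ => jH lam alp t p.1 p.2)
      (volume.prod (volume.restrict (Set.Ioc (0:ℝ) 1))) := by
  rw [integrable_prod_iff' (jH_cont lam alp t).aestronglyMeasurable]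
  constructor
  · refine Filter.Eventually.of_forall fun v => ?_
    exact (shift_int (1 + lam * t * v) (alp * v * Real.sqrt t / 2)
      (alp * v * Real.sqrt t)).const_mul (lam * Real.exp (lam * t * v))
  · have hc : Continuous (fun v : ℝ => lam * Real.exp (lam * t * v) *
      ((1 + lam * t * v) + alp * v * Real.sqrt t / 2 * Real.sqrt (2 / Real.pi))) := by fun_prop
    refine Integrable.congr ((hc.integrableOn_Icc (a := 0) (b := 1)).mono_set
      Set.Ioc_subset_Icc_self) ?_
    filter_upwards [ae_restrict_mem measurableSet_Ioc] with v hv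
    rw [← jH_total]
    refine integral_congr_ae (Filter.Eventually.of_forall fun z => ?_)
    exact (Real.norm_of_nonneg (jH_nonneg lam alp t z v hlam halp ht hv.1.le)).symm

lemma jH_double (lam alp t : ℝ) (hlam : 0 < lam) (halp : 0 < alp) (ht : 0 < t) :
    ∫ z, ∫ v in Set.Ioc (0:ℝ) 1, jH lam alp t z v ≤
      Real.exp (lam * t) * (lam + (1 / 2) * alp * Real.sqrt (2 / Real.pi) / Real.sqrt t) := by
  rw [integral_integral_swap (jH_prod lam alp t hlam halp ht)]
  simp_rw [jH_total]
  rw [← intervalIntegral.integral_of_le zero_le_one]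
  set C := Real.sqrt (2 / Real.pi) with hC
  have hC0 : 0 ≤ C := Real.sqrt_nonneg _
  have hq : 0 < Real.sqrt t := Real.sqrt_pos.2 ht
  have hqq : Real.sqrt t * Real.sqrt t = t := Real.mul_self_sqrt ht.le
  set B := (1 / 2) * alp * C / Real.sqrt t with hB
  have hB0 : 0 ≤ B := by positivity
  have hBt : B * t = alp * Real.sqrt t / 2 * C := by
    rw [hB]; field_simp; nlinarith
  have hder : ∀ v : ℝ, HasDerivAt (fun v => lam * (v * Real.exp (lam * t * v))
      + B * Real.exp (lam * t * v))
      (lam * Real.exp (lam * t * v) * ((1 + lam * t * v) + B * t)) v := by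
    intro v
    have h1 := ((hasDerivAt_id v).const_mul (lam * t)).exp
    have h2 := (((hasDerivAt_id v).mul h1).const_mul lam).add (h1.const_mul B)
    refine h2.congr_deriv ?_
    simp only [id]
    ring
  have hint := intervalIntegral.integral_eq_sub_of_hasDerivAt (a := 0) (b := 1)
    (fun v _ => hder v) (Continuous.intervalIntegrable (by fun_prop) _ _)
  calc _ ≤ ∫ v in (0:ℝ)..1, lam * Real.exp (lam * t * v) * ((1 + lam * t * v) + B * t) := by
        refine intervalIntegral.integral_mono_on zero_le_one
          (Continuous.intervalIntegrable (by fun_prop) _ _)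
          (Continuous.intervalIntegrable (by fun_prop) _ _) fun v hv => ?_
        rw [hBt]
        have : alp * v * Real.sqrt t / 2 * C ≤ alp * Real.sqrt t / 2 * C := by
          have : alp * v ≤ alp := mul_le_of_le_one_right halp.le hv.2
          gcongr
        gcongr
    _ ≤ _ := by
        rw [hint]
        simp
        nlinarith [Real.exp_pos (lam * t)]

/-- The first term. -/
lemma first_le (lam alp t φ z : ℝ) (hlam : 0 < lam) (halp : 0 < alp) (ht : 0 < t) (hφ : 0 ≤ φ) :
    |Real.exp (alp * z * Real.sqrt t + (lam - alp ^ 2 / 2) * t) *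
        (alp * z * (1 / (2 * Real.sqrt t)) + (lam - alp ^ 2 / 2)) * φ| * gaussDensity z ≤
    φ * Real.exp (lam * t) * ((lam + alp / (2 * Real.sqrt t) * |z - alp * Real.sqrt t|) *
      gaussDensity (z - alp * Real.sqrt t)) := by
  have hqq : Real.sqrt t ^ 2 = t := Real.sq_sqrt ht.le
  have hq : 0 < Real.sqrt t := Real.sqrt_pos.2 ht
  rw [← gd_shift z (alp * Real.sqrt t)]
  have e1 : Real.exp (alp * z * Real.sqrt t + (lam - alp ^ 2 / 2) * t)
     = Real.exp (lam * t) * Real.exp (alp * Real.sqrt t * z - (alp * Real.sqrt t) ^ 2 / 2) := by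
    rw [← Real.exp_add]
    congr 1
    linear_combination (alp ^ 2 / 2) * hqq
  have e2 : alp * z * (1 / (2 * Real.sqrt t)) + (lam - alp ^ 2 / 2)
      = lam + alp / (2 * Real.sqrt t) * (z - alp * Real.sqrt t) := by
    field_simp
    ring
  have h : |lam + alp / (2 * Real.sqrt t) * (z - alp * Real.sqrt t)| ≤
      lam + alp / (2 * Real.sqrt t) * |z - alp * Real.sqrt t| := by
    refine (abs_add_le _ _).trans ?_
    rw [abs_mul, abs_of_pos hlam, abs_of_nonneg (show 0 ≤ alp / (2 * Real.sqrt t) by positivity)]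
  rw [e1, e2, abs_mul, abs_mul, abs_mul, abs_exp, abs_exp, abs_of_nonneg hφ]
  have := gd_nonneg z
  calc _ ≤ Real.exp (lam * t) * Real.exp (alp * Real.sqrt t * z - (alp * Real.sqrt t) ^ 2 / 2) *
        (lam + alp / (2 * Real.sqrt t) * |z - alp * Real.sqrt t|) * φ * gaussDensity z := by gcongr
    _ = _ := by ring

/-- The map `s ↦ j(s, φ, z)` is differentiable at each `t > 0`, and the Gaussian
integral of `|∂ₜ j(t, φ, z)|` is bounded by
`e^{λt} (φ((1/2)αC₁ t^{−1/2} + λ) + λ + (1/2)αC₁ t^{−1/2})`, where `C₁ = √(2/π)`. -/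
theorem jfun_time_deriv_gaussian_bound (lam alp : ℝ) (hlam : 0 < lam) (halp : 0 < alp)
    (t : ℝ) (ht : 0 < t) (φ : ℝ) (hφ : 0 ≤ φ) :
    (∀ z : ℝ, DifferentiableAt ℝ (fun s : ℝ => jfun lam alp s φ z) t) ∧
      ∫ z : ℝ, |deriv (fun s : ℝ => jfun lam alp s φ z) t| * gaussDensity z ≤
        Real.exp (lam * t) *
          (φ * ((1 / 2) * alp * Real.sqrt (2 / Real.pi) / Real.sqrt t + lam) + lam +
            (1 / 2) * alp * Real.sqrt (2 / Real.pi) / Real.sqrt t) := by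
  refine ⟨fun z => (jfun_hasDeriv lam alp φ z t ht).differentiableAt, ?_⟩
  have i1 := (shift_int lam (alp / (2 * Real.sqrt t)) (alp * Real.sqrt t)).const_mul
    (φ * Real.exp (lam * t))
  have i2 := (jH_prod lam alp t hlam halp ht).integral_prod_left
  have hmono : ∫ z : ℝ, |deriv (fun s : ℝ => jfun lam alp s φ z) t| * gaussDensity z ≤
      ∫ z : ℝ, (φ * Real.exp (lam * t) *
        ((lam + alp / (2 * Real.sqrt t) * |z - alp * Real.sqrt t|) *
          gaussDensity (z - alp * Real.sqrt t))
        + ∫ v in Set.Ioc (0:ℝ) 1, jH lam alp t z v) := by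
    refine integral_mono_of_nonneg
      (Filter.Eventually.of_forall fun z => mul_nonneg (abs_nonneg _) (gd_nonneg z))
      (i1.add i2) (Filter.Eventually.of_forall fun z => ?_)
    simp only
    rw [(jfun_hasDeriv lam alp φ z t ht).deriv]
    refine (mul_le_mul_of_nonneg_right (abs_add_le _ _) (gd_nonneg z)).trans ?_
    rw [add_mul]
    refine add_le_add (first_le lam alp t φ z hlam halp ht hφ) ?_
    have hc1 : Continuous (fun v => jD lam alp z t v) := by unfold jD; fun_prop
    have hc2 : Continuous (fun v => jH lam alp t z v) := by unfold jH gaussDensity; fun_prop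
    refine (mul_le_mul_of_nonneg_right
      (intervalIntegral.abs_integral_le_integral_abs zero_le_one) (gd_nonneg z)).trans ?_
    rw [← intervalIntegral.integral_mul_const, ← intervalIntegral.integral_of_le zero_le_one]
    refine intervalIntegral.integral_mono_on zero_le_one
      ((hc1.abs.mul continuous_const).intervalIntegrable _ _) (hc2.intervalIntegrable _ _) ?_
    exact fun v hv => jD_le lam alp t z v hlam halp ht hv.1
  refine hmono.trans ?_
  rw [integral_add i1 i2, integral_const_mul, shift_total]
  have h := jH_double lam alp t hlam halp ht
  refine (add_le_add_right h _).trans (le_of_eq ?_)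
  have hq : 0 < Real.sqrt t := Real.sqrt_pos.2 ht
  field_simp
  ring
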